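/- arXiv:1801.00827 — 4 statements merged into one kernel-verified Lean document; each statement's English description precedes it below -/
import Mathlib

section
/- Theorem (Theorem 4.4, first part): The set IMPS(2,4,3) ⊆ ((Fin 3 → Fin 4) → ℂ), consisting of all tensors T with T(i_1,i_2,i_3) = trace(M_{i_1} M_{i_2} M_{i_3}) for some 2×2 complex matrices M_1, M_2, M_3, M_4, is not a closed subset of the space (Fin 3 → Fin 4) → ℂ with its standard topology. -/
/-- The limit tensor. -/
def impsLim : Fin 4 → Fin 4 → Fin 4 → ℂ
  | 0, 1, 2 => 1
  | 1, 2, 0 => 1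
  | 2, 0, 1 => 1
  | 0, 2, 1 => 1
  | 2, 1, 0 => 1
  | 1, 0, 2 => 1
  | 1, 2, 3 => 1
  | 2, 3, 1 => 1
  | 3, 1, 2 => 1
  | 2, 1, 3 => -1
  | 1, 3, 2 => -1
  | 3, 2, 1 => -1
  | _, _, _ => 0

/-- Matrices of the error term. -/
def impsErr : Fin 4 → Matrix (Fin 2) (Fin 2) ℂ :=
  ![1, 0, 0, !![1, 0; 0, -1]]

/-- The degenerating family. -/
noncomputable def impsFam (t : ℂ) : Fin 4 → Matrix (Fin 2) (Fin 2) ℂ :=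
  ![!![t, 0; 0, t], !![0, 1; 0, 0], !![0, 0; t⁻¹, 0], !![t, 0; 0, -t]]

theorem impsFam_trace (t : ℂ) (ht : t ≠ 0) (a b c : Fin 4) :
    impsLim a b c + t ^ 3 * Matrix.trace (impsErr a * impsErr b * impsErr c)
      = Matrix.trace (impsFam t a * impsFam t b * impsFam t c) := by
  fin_cases a <;> fin_cases b <;> fin_cases c <;>
    simp [impsLim, impsErr, impsFam, Matrix.trace_fin_two, ht,
      Matrix.one_fin_two] <;> ring

theorem impsLim_not_mem (M : Fin 4 → Matrix (Fin 2) (Fin 2) ℂ)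
    (h : ∀ a b c, impsLim a b c = Matrix.trace (M a * M b * M c)) : False := by
  have hli : LinearIndependent ℂ M := by
    rw [Fintype.linearIndependent_iff]
    intro g hg
    have key : ∀ b c, ∑ a, g a * impsLim a b c = 0 := by
      intro b c
      have : Matrix.trace ((∑ a, g a • M a) * M b * M c) = 0 := by rw [hg]; simp
      rw [← this]
      simp [Finset.sum_mul, Matrix.trace_sum, h]
    have h1 := key 1 2
    have h2 := key 2 1
    have h3 := key 0 2
    have h4 := key 0 1
    simp [Fin.sum_univ_four, impsLim] at h1 h2 h3 h4
    have h5 : g 0 = 0 := by linear_combination (h1 + h2) / 2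
    have h6 : g 3 = 0 := by linear_combination (h1 - h2) / 2
    intro i
    fin_cases i <;> simp_all
  have hspan : Submodule.span ℂ (Set.range M) = ⊤ :=
    hli.span_eq_top_of_card_eq_finrank' (by simp [Module.finrank_matrix])
  have hnd : ∀ a b, (∀ c, impsLim a b c = 0) → M a * M b = 0 := by
    intro a b hab
    have hz : (Matrix.traceLinearMap (Fin 2) ℂ ℂ) ∘ₗ (LinearMap.mulLeft ℂ (M a * M b)) = 0 := by
      apply LinearMap.ext_on_range hspan
      intro c
      have hc := hab c
      rw [h] at hc
      simpa [Matrix.mul_assoc] using hc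
    rw [Matrix.ext_iff_trace_mul_right]
    intro X
    have := LinearMap.congr_fun hz X
    simpa [Matrix.mul_assoc] using this
  have hAA := hnd 0 0 (by intro c; fin_cases c <;> simp [impsLim])
  have hAD := hnd 0 3 (by intro c; fin_cases c <;> simp [impsLim])
  have hDA := hnd 3 0 (by intro c; fin_cases c <;> simp [impsLim])
  have hDD := hnd 3 3 (by intro c; fin_cases c <;> simp [impsLim])
  have hne : M 0 ≠ 0 := hli.ne_zero 0
  have hsq : ∀ N : Matrix (Fin 2) (Fin 2) ℂ, N * N = 0 → N 1 1 = - N 0 0 := by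
    intro N hN
    have e1 := congrFun (congrFun hN 0) 0
    have e2 := congrFun (congrFun hN 0) 1
    have e3 := congrFun (congrFun hN 1) 0
    have e4 := congrFun (congrFun hN 1) 1
    simp [Matrix.mul_apply] at e1 e2 e3 e4
    by_contra hc
    have hc' : N 0 0 + N 1 1 ≠ 0 := fun h => hc (by linear_combination h)
    have f2 : N 0 1 = 0 := by
      apply (mul_eq_zero.mp (_ : (N 0 0 + N 1 1) * N 0 1 = 0)).resolve_left hc'
      linear_combination e2
    simp [f2] at e1 e4
    exact hc (by simp [e1, e4])
  have tA := hsq _ hAA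
  have tD := hsq _ hDD
  have p1 := congrFun (congrFun hAD 0) 0
  have p2 := congrFun (congrFun hAD 0) 1
  have p3 := congrFun (congrFun hAD 1) 0
  have p4 := congrFun (congrFun hAD 1) 1
  have q1 := congrFun (congrFun hDA 0) 0
  have q2 := congrFun (congrFun hDA 0) 1
  have q3 := congrFun (congrFun hDA 1) 0
  have q4 := congrFun (congrFun hDA 1) 1
  simp [Matrix.mul_apply, tA, tD] at p1 p2 p3 p4 q1 q2 q3 q4
  have hpair : ∀ x y : ℂ, x • M 0 + y • M 3 = 0 → y = 0 := by
    intro x y hxy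
    rw [Fintype.linearIndependent_iff] at hli
    have := hli ![x, 0, 0, y] (by simpa [Fin.sum_univ_four] using hxy) 3
    simpa using this
  have hprop : ∀ i j, M 0 i j = 0 := by
    intro i j
    apply hpair (-(M 3 i j))
    ext k l
    fin_cases i <;> fin_cases j <;> fin_cases k <;> fin_cases l <;> simp [tA, tD] <;> grind
  exact hne (by ext i j; simp [hprop])

/-- Theorem 4.4 (first part): `IMPS(2,4,3)` is not a closed subset of the space of
tensors `(Fin 3 → Fin 4) → ℂ`. -/
theorem imps_two_four_three_not_closed :
    ¬ IsClosed {T : (Fin 3 → Fin 4) → ℂ |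
      ∃ M : Fin 4 → Matrix (Fin 2) (Fin 2) ℂ,
        ∀ i : Fin 3 → Fin 4, T i = Matrix.trace (M (i 0) * M (i 1) * M (i 2))} := by
  intro hcl
  let F : ℂ → (Fin 3 → Fin 4) → ℂ := fun t i => impsLim (i 0) (i 1) (i 2) +
    t ^ 3 * Matrix.trace (impsErr (i 0) * impsErr (i 1) * impsErr (i 2))
  have hF : Continuous F := by
    apply continuous_pi
    intro i
    fun_prop
  have hpre := hcl.preimage hF
  have h0 := (hpre.closure_subset_iff (s := ({0}ᶜ : Set ℂ))).mpr (by
    intro t ht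
    exact ⟨impsFam t, fun i => impsFam_trace t ht (i 0) (i 1) (i 2)⟩)
    ((dense_compl_singleton (0 : ℂ)) 0)
  obtain ⟨M, hM⟩ := h0
  apply impsLim_not_mem M
  intro a b c
  simpa [F] using hM ![a, b, c]
end

section
/- Theorem (Theorem 4.6): For every odd integer q > 1, the set IMPS(2,4,q) ⊆ ((Fin q → Fin 4) → ℂ) is not a closed subset of the space of tensors (Fin q → Fin 4) → ℂ with its standard topology. -/
/-- weights of the four letters -/
def impsWt : Fin 4 → ℕ := ![0, 1, 1, 2]

/-- the leading matrices -/
def impsN : Fin 4 → Matrix (Fin 2) (Fin 2) ℂ :=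
  ![!![1, 0; 0, -1], !![0, 1; 0, 0], !![0, 0; 1, 0], !![1, 0; 0, 0]]

lemma impsN_sq : impsN 0 * impsN 0 = 1 := by
  ext i j; fin_cases i <;> fin_cases j <;> simp [impsN, Matrix.mul_apply]

lemma impsN_pow_even (m : ℕ) : impsN 0 ^ (2 * m) = 1 := by
  rw [pow_mul, pow_two, impsN_sq, one_pow]

lemma impsN_pow_diag (n : ℕ) : (impsN 0 ^ n) 0 1 = 0 ∧ (impsN 0 ^ n) 1 0 = 0 := by
  induction n with
  | zero => simp
  | succ n ih => 
    rw [pow_succ]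
    generalize impsN 0 ^ n = Q at ih
    simp [Matrix.mul_apply, Fin.sum_univ_two, ih, impsN]

lemma imps_low (L : List (Fin 4)) :
    ((L.map impsWt).sum = 0 → (L.map impsN).prod = impsN 0 ^ L.length) ∧
    ((L.map impsWt).sum = 1 → (L.map impsN).prod 0 0 = 0 ∧ (L.map impsN).prod 1 1 = 0) := by
  induction L with
  | nil => simp
  | cons i L ih =>
    obtain ⟨h0, h1⟩ := ih
    simp only [List.map_cons, List.sum_cons, List.prod_cons, List.length_cons]
    have hd := impsN_pow_diag L.length
    refine ⟨fun h => ?_, fun h => ?_⟩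
    · have hL : (L.map impsWt).sum = 0 := by omega
      have hi : i = 0 := by
        have : impsWt i = 0 := by omega
        revert this; fin_cases i <;> simp [impsWt]
      rw [h0 hL, hi, pow_succ']
    · have hi : (i = 0 ∧ (L.map impsWt).sum = 1) ∨ (i = 1 ∧ (L.map impsWt).sum = 0) ∨
          (i = 2 ∧ (L.map impsWt).sum = 0) := by
        generalize (L.map impsWt).sum = s at h
        revert h; fin_cases i <;> simp [impsWt] <;> omega
      rcases hi with ⟨rfl, hL⟩ | ⟨rfl, hL⟩ | ⟨rfl, hL⟩
      · have := h1 hL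
        generalize (L.map impsN).prod = Q at this
        simp [Matrix.mul_apply, Fin.sum_univ_two, this, impsN]
      · rw [h0 hL]
        generalize impsN 0 ^ L.length = Q at hd
        simp [Matrix.mul_apply, Fin.sum_univ_two, hd, impsN]
      · rw [h0 hL]
        generalize impsN 0 ^ L.length = Q at hd
        simp [Matrix.mul_apply, Fin.sum_univ_two, hd, impsN]

/-- the limit tensor, on words -/
noncomputable def impsF (L : List (Fin 4)) : ℂ :=
  if (L.map impsWt).sum = 2 then (L.map impsN).prod.trace else 0

lemma imps_low_trace (L : List (Fin 4)) (hL : Odd L.length) (h : (L.map impsWt).sum < 2) :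
    (L.map impsN).prod.trace = 0 := by
  obtain ⟨h0, h1⟩ := imps_low L
  rw [Matrix.trace_fin_two]
  have : (L.map impsWt).sum = 0 ∨ (L.map impsWt).sum = 1 := by omega
  rcases this with h | h
  · obtain ⟨m, hm⟩ := hL
    rw [h0 h, hm, pow_succ, impsN_pow_even]
    simp [impsN]
  · simp [h1 h]

/-- the approximating matrices -/
noncomputable def impsM (q : ℕ) (e : ℂ) (i : Fin 4) : Matrix (Fin 2) (Fin 2) ℂ :=
  ((e ^ q) ^ impsWt i * (e ^ 2)⁻¹) • impsN i

lemma impsM_prod (q : ℕ) (e : ℂ) (L : List (Fin 4)) :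
    (L.map (impsM q e)).prod =
      ((e ^ q) ^ (L.map impsWt).sum * ((e ^ 2)⁻¹) ^ L.length) • (L.map impsN).prod := by
  induction L with
  | nil => simp
  | cons i L ih =>
    simp only [List.map_cons, List.sum_cons, List.prod_cons, List.length_cons, ih]
    rw [impsM, smul_mul_smul_comm]
    congr 1
    ring

open Filter Topology in
lemma imps_tendsto (q : ℕ) (hodd : Odd q) (L : List (Fin 4)) (hL : L.length = q) :
    Tendsto (fun e : ℂ => (L.map (impsM q e)).prod.trace) (𝓝[≠] 0) (𝓝 (impsF L)) := by
  have hq : q ≠ 0 := by rintro rfl; simp at hodd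
  rcases lt_or_ge (L.map impsWt).sum 2 with h | h
  · have h0 := imps_low_trace L (hL ▸ hodd) h
    have h1 : impsF L = 0 := by simp [impsF, h.ne]
    simp only [impsM_prod, Matrix.trace_smul, h0, h1, smul_zero]
    exact tendsto_const_nhds
  · obtain ⟨s, hs⟩ := Nat.exists_eq_add_of_le h
    have h1 : impsF L = ((0 : ℂ) ^ q) ^ s * (L.map impsN).prod.trace := by
      rcases Nat.eq_zero_or_pos s with rfl | hs0
      · simp [impsF, hs]
      · have : (L.map impsWt).sum ≠ 2 := by omega
        simp [impsF, this, hq, hs0.ne']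
    rw [h1]
    have h2 : Tendsto (fun e : ℂ => (e ^ q) ^ s * (L.map impsN).prod.trace) (𝓝[≠] 0)
        (𝓝 (((0 : ℂ) ^ q) ^ s * (L.map impsN).prod.trace)) := by
      have : Continuous (fun e : ℂ => (e ^ q) ^ s * (L.map impsN).prod.trace) := by fun_prop
      exact (this.tendsto 0).mono_left nhdsWithin_le_nhds
    refine h2.congr' ?_
    filter_upwards [self_mem_nhdsWithin] with e he
    have he : e ≠ 0 := he
    rw [impsM_prod, Matrix.trace_smul, hs, hL, smul_eq_mul]
    congr 1
    rw [pow_add, inv_pow, ← pow_mul e 2 q, ← pow_mul e q 2, mul_comm 2 q]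
    have : e ^ (q * 2) ≠ 0 := pow_ne_zero _ he
    field_simp

lemma imps_zero_of_trace (M : Fin 4 → Matrix (Fin 2) (Fin 2) ℂ)
    (hs : ∀ X, ∃ c : Fin 4 → ℂ, ∑ i, c i • M i = X) (n : ℕ) :
    ∀ P : Matrix (Fin 2) (Fin 2) ℂ,
      (∀ L : List (Fin 4), L.length = n + 1 → (P * (L.map M).prod).trace = 0) → P = 0 := by
  induction n with
  | zero =>
    intro P h
    have hX : ∀ X, (P * X).trace = 0 := by
      intro X
      obtain ⟨c, rfl⟩ := hs X
      have : ∀ i, (P * M i).trace = 0 := fun i => by simpa using h [i] rfl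
      simp [Matrix.mul_sum, Matrix.trace_sum, this]
    exact Matrix.ext_iff_trace_mul_right.mpr (by simpa using hX)
  | succ n ih =>
    intro P h
    have h1 : ∀ i, P * M i = 0 := fun i => ih _ fun L hL => by
      simpa [mul_assoc] using h (i :: L) (by simp [hL])
    obtain ⟨c, hc⟩ := hs 1
    rw [← mul_one P, ← hc]
    simp [Matrix.mul_sum, h1]

lemma imps_not_mem (m : ℕ) (M : Fin 4 → Matrix (Fin 2) (Fin 2) ℂ)
    (h : ∀ L : List (Fin 4), L.length = 2 * m + 3 → (L.map M).prod.trace = impsF L) : False := by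
  have hpow : impsN 0 ^ (2 * m + 1) = impsN 0 := by rw [pow_succ, impsN_pow_even, one_mul]
  have key : ∀ i j, (M i * (M j * M 0 ^ (2 * m + 1))).trace =
      if impsWt i + impsWt j = 2 then (impsN i * (impsN j * impsN 0)).trace else 0 := by
    intro i j
    have := h (i :: j :: List.replicate (2 * m + 1) 0) (by simp)
    have w0 : impsWt 0 = 0 := rfl
    simpa [impsF, hpow, w0] using this
  have hli : LinearIndependent ℂ M := by
    rw [Fintype.linearIndependent_iff]
    intro c hc
    have k : ∀ j, ∑ i, c i * (M i * (M j * M 0 ^ (2 * m + 1))).trace = 0 := by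
      intro j
      have : ((∑ i, c i • M i) * (M j * M 0 ^ (2 * m + 1))).trace = 0 := by rw [hc]; simp
      simpa [Matrix.sum_mul, Matrix.trace_sum] using this
    simp only [key] at k
    have k0 := k 0
    have k1 := k 1
    have k2 := k 2
    have k3 := k 3
    simp [Fin.sum_univ_four, impsWt, impsN, Matrix.trace_fin_two] at k0 k1 k2 k3
    intro i
    fin_cases i <;> simp_all
  have hs : ∀ X, ∃ c : Fin 4 → ℂ, ∑ i, c i • M i = X := by
    intro X
    have ht := hli.span_eq_top_of_card_eq_finrank' (by simp [Module.finrank_matrix])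
    have : X ∈ Submodule.span ℂ (Set.range M) := by rw [ht]; trivial
    exact (Submodule.mem_span_range_iff_exists_fun ℂ).mp this
  have hz : ∀ i, i ≠ 0 → M 3 * M i = 0 := by
    intro i hi
    refine imps_zero_of_trace M hs (2 * m) _ fun L hL => ?_
    have h1 := h (3 :: i :: L) (by simp [hL])
    have h2 : impsF (3 :: i :: L) = 0 := by
      have : 1 ≤ impsWt i := by revert hi; fin_cases i <;> simp [impsWt]
      have w3 : impsWt 3 = 2 := rfl
      rw [impsF, if_neg]
      simp only [List.map_cons, List.sum_cons, w3]
      omega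
    rw [h2] at h1
    simpa [mul_assoc] using h1
  have hP : ∀ X, ∃ c : ℂ, M 3 * X = c • (M 3 * M 0) := by
    intro X
    obtain ⟨c, rfl⟩ := hs X
    refine ⟨c 0, ?_⟩
    simp [Matrix.mul_add, Fin.sum_univ_four, hz]
  have hW : M 3 ≠ 0 := hli.ne_zero 3
  apply hW
  ext i j
  obtain ⟨c, hc⟩ := hP (Matrix.single j 0 1)
  obtain ⟨d, hd⟩ := hP (Matrix.single j 1 1)
  generalize M 3 * M 0 = P at hc hd
  have c0 := congrFun (congrFun hc i) 0
  have d0 := congrFun (congrFun hd i) 0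
  have d1 := congrFun (congrFun hd i) 1
  simp at c0 d0 d1
  rcases d0 with h | h
  · simp [d1, h]
  · simp [c0, h]

open Filter Topology in
/-- Theorem 4.6: for every odd integer `q > 1`, the set `IMPS(2,4,q)` is not a closed
subset of the space of tensors `(Fin q → Fin 4) → ℂ`. -/
theorem imps_two_four_odd_not_closed (q : ℕ) (hq : 1 < q) (hodd : Odd q) :
    ¬ IsClosed {T : (Fin q → Fin 4) → ℂ |
      ∃ M : Fin 4 → Matrix (Fin 2) (Fin 2) ℂ,
        ∀ i : Fin q → Fin 4, T i = Matrix.trace (List.ofFn fun j => M (i j)).prod} := by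
  intro hcl
  have hmap : ∀ (M : Fin 4 → Matrix (Fin 2) (Fin 2) ℂ) (i : Fin q → Fin 4),
      (List.ofFn fun j => M (i j)) = (List.ofFn i).map M := by
    intro M i
    rw [List.map_ofFn]; rfl
  have hlim : Tendsto (fun (e : ℂ) (i : Fin q → Fin 4) =>
      ((List.ofFn i).map (impsM q e)).prod.trace) (𝓝[≠] 0) (𝓝 fun i => impsF (List.ofFn i)) :=
    tendsto_pi_nhds.mpr fun i => imps_tendsto q hodd _ (by simp)
  have hmem := hcl.mem_of_tendsto hlim (Eventually.of_forall fun e =>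
    ⟨impsM q e, fun i => by rw [hmap]⟩)
  obtain ⟨M, hM⟩ := hmem
  obtain ⟨m, rfl⟩ : ∃ m, q = 2 * m + 3 := by
    obtain ⟨k, hk⟩ := hodd
    exact ⟨k - 1, by omega⟩
  refine imps_not_mem m M fun L hL => ?_
  obtain ⟨i, rfl⟩ : ∃ i : Fin (2 * m + 3) → Fin 4, L = List.ofFn i := by
    rw [← hL]
    exact ⟨L.get, (List.ofFn_get L).symm⟩
  rw [← hmap]
  exact (hM i).symm
end

section
/- Theorem (Theorem 4.6, strengthened form): For every odd integer q > 1, there exists a tensor T : (Fin q → Fin 4) → ℂ lying in the closure of IMPS(2,4,q) (in the standard topology on the space of tensors) that does not lie in MPS((2,…,2),(4,…,4),q); that is, there do not exist 2×2 complex matrices M_{i,j} (j = 1,…,q, i = 1,…,4) with T(i_1,…,i_q) = trace(M_{i_1,1} ⋯ M_{i_q,q}) for all multi-indices. -/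
open Filter Topology

/-- Letters: `0,1,2,3` stand for the matrix units `E₀₀, E₀₁, E₁₀, E₁₁`. -/
def unitMat : Fin 4 → Matrix (Fin 2) (Fin 2) ℂ :=
  ![!![1, 0; 0, 0], !![0, 1; 0, 0], !![0, 0; 1, 0], !![0, 0; 0, 1]]

/-- Is the letter diagonal? -/
def isDg (k : Fin 4) : Bool := k == 0 || k == 3

/-- The limit tensor on words. -/
noncomputable def valT (l : List (Fin 4)) : ℂ :=
  if l.countP isDg = 1 then Matrix.trace (l.map unitMat).prod else 0

/-- Approximating matrices. -/
noncomputable def apprM (q : ℕ) (s : ℂ) (k : Fin 4) : Matrix (Fin 2) (Fin 2) ℂ :=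
  (s⁻¹ * (if isDg k then s ^ q else 1)) • unitMat k

lemma apprM_prod (q : ℕ) (s : ℂ) (l : List (Fin 4)) :
    (l.map (apprM q s)).prod
      = (s⁻¹ ^ l.length * (s ^ q) ^ (l.countP isDg)) • (l.map unitMat).prod := by
  induction l with
  | nil => simp
  | cons k l ih =>
    simp only [List.map_cons, List.prod_cons, ih, apprM, List.length_cons, List.countP_cons,
      smul_mul_assoc, mul_smul_comm, smul_smul]
    congr 1
    split_ifs <;> ring

lemma offdiag_prod (l : List (Fin 4)) (h : l.countP isDg = 0) :
    (Odd l.length → (l.map unitMat).prod 0 0 = 0 ∧ (l.map unitMat).prod 1 1 = 0) ∧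
    (Even l.length → (l.map unitMat).prod 0 1 = 0 ∧ (l.map unitMat).prod 1 0 = 0) := by
  induction l with
  | nil => simp
  | cons k l ih =>
    rw [List.countP_cons] at h
    have h1 : l.countP isDg = 0 := by omega
    have h2 : isDg k = false := by
      by_contra hk
      simp at hk
      simp [hk] at h
    obtain ⟨i1, i2⟩ := ih h1
    simp only [List.map_cons, List.prod_cons, List.length_cons, Nat.odd_add_one, Nat.even_add_one,
      Nat.not_odd_iff_even, Nat.not_even_iff_odd, Matrix.mul_apply, Fin.sum_univ_two]
    refine ⟨fun he => ?_, fun ho => ?_⟩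
    · obtain ⟨a, b⟩ := i2 he
      fin_cases k <;> simp_all [unitMat, isDg]
    · obtain ⟨a, b⟩ := i1 ho
      fin_cases k <;> simp_all [unitMat, isDg]

lemma valT_mem_closure (q : ℕ) (hq : 1 < q) (hodd : Odd q) :
    (fun i : Fin q → Fin 4 => valT (List.ofFn i)) ∈ closure {T : (Fin q → Fin 4) → ℂ |
        ∃ M : Fin 4 → Matrix (Fin 2) (Fin 2) ℂ,
          ∀ i : Fin q → Fin 4, T i = Matrix.trace (List.ofFn fun j => M (i j)).prod} := by
  let g : ℂ → (Fin q → Fin 4) → ℂ := fun s i =>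
    if (List.ofFn i).countP isDg = 0 then 0 else
      s ^ (q * ((List.ofFn i).countP isDg - 1)) * Matrix.trace ((List.ofFn i).map unitMat).prod
  have hg : Continuous g := by
    refine continuous_pi fun i => ?_
    by_cases h : (List.ofFn i).countP isDg = 0
    · simp only [g, h, if_true]; fun_prop
    · simp only [g, h, if_false]; fun_prop
  have hg0 : g 0 = fun i : Fin q → Fin 4 => valT (List.ofFn i) := by
    funext i
    simp only [g, valT]
    rcases Nat.lt_trichotomy ((List.ofFn i).countP isDg) 1 with h | h | h
    · have h0 : (List.ofFn i).countP isDg = 0 := by omega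
      simp [h0]
    · simp [h]
    · rw [if_neg (by omega), if_neg (by omega), zero_pow, zero_mul]
      have : 0 < q * ((List.ofFn i).countP isDg - 1) := Nat.mul_pos (by omega) (by omega)
      omega
  have ht : Tendsto g (𝓝[≠] (0 : ℂ)) (𝓝 (fun i : Fin q → Fin 4 => valT (List.ofFn i))) := by
    rw [← hg0]
    exact hg.continuousAt.tendsto.mono_left nhdsWithin_le_nhds
  refine mem_closure_of_tendsto ht ?_
  filter_upwards [self_mem_nhdsWithin] with s hs
  have hs : s ≠ 0 := hs
  refine ⟨apprM q s, fun i => ?_⟩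
  have e : (List.ofFn fun j => apprM q s (i j)) = (List.ofFn i).map (apprM q s) := by
    rw [List.map_ofFn]; rfl
  rw [e, apprM_prod, Matrix.trace_smul, List.length_ofFn, smul_eq_mul]
  simp only [g]
  split_ifs with h
  · have := (offdiag_prod _ h).1 (by rwa [List.length_ofFn])
    rw [Matrix.trace_fin_two, this.1, this.2, add_zero, mul_zero]
  · congr 1
    obtain ⟨c, hc⟩ : ∃ c, (List.ofFn i).countP isDg = c + 1 := Nat.exists_eq_succ_of_ne_zero h
    rw [hc, ← pow_mul, Nat.add_sub_cancel, Nat.mul_add, mul_one, pow_add, inv_pow]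
    field_simp

/-- A matrix orthogonal to a dual family of four matrices vanishes. -/
lemma eq_zero_of_dual (N Z : Fin 4 → Matrix (Fin 2) (Fin 2) ℂ)
    (h : ∀ i j, Matrix.trace (N i * Z j) = if i = j then 1 else 0)
    (Q : Matrix (Fin 2) (Fin 2) ℂ) (hQ : ∀ j, Matrix.trace (Q * Z j) = 0) : Q = 0 := by
  have hli : LinearIndependent ℂ Z := by
    rw [Fintype.linearIndependent_iff]
    intro c hc i
    have := congrArg (fun X => Matrix.trace (N i * X)) hc
    simpa [Finset.mul_sum, Matrix.trace_sum, h] using this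
  have hspan : Submodule.span ℂ (Set.range Z) = ⊤ :=
    hli.span_eq_top_of_card_eq_finrank' (by simp [Module.finrank_matrix])
  have hall : ∀ X, Matrix.trace (Q * X) = 0 := by
    intro X
    have hX : X ∈ Submodule.span ℂ (Set.range Z) := by rw [hspan]; trivial
    induction hX using Submodule.span_induction with
    | mem x hx => obtain ⟨j, rfl⟩ := hx; exact hQ j
    | zero => simp
    | add x y _ _ hx hy => rw [mul_add, Matrix.trace_add, hx, hy, add_zero]
    | smul a x _ hx => rw [mul_smul_comm, Matrix.trace_smul, hx, smul_zero]
  ext i j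
  have := hall (Matrix.single j i 1)
  simpa [Matrix.trace_mul_single] using this

/-- Nonzero annihilators on both sides force two `2 × 2` matrices to be proportional. -/
lemma cross_eq (A C X Y G H : Matrix (Fin 2) (Fin 2) ℂ) (hA : A ≠ 0) (hC : C ≠ 0)
    (h1 : A * X = 0) (h2 : A * Y = 0) (h3 : X * C = 0) (h4 : Y * C = 0) :
    Matrix.trace (X * G) * Matrix.trace (Y * H) = Matrix.trace (Y * G) * Matrix.trace (X * H) := by
  obtain ⟨w, hw⟩ : ∃ i, ∃ j, A i j ≠ 0 := by
    by_contra! hh; exact hA (by ext i j; exact hh i j)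
  obtain ⟨v, hv⟩ : ∃ j, ∃ i, C i j ≠ 0 := by
    by_contra! hh; exact hC (by ext i j; exact hh j i)
  have e1 : ∀ j, A w 0 * X 0 j + A w 1 * X 1 j = 0 := fun j => by
    have := congrFun (congrFun h1 w) j
    simpa [Matrix.mul_apply, Fin.sum_univ_two] using this
  have e2 : ∀ j, A w 0 * Y 0 j + A w 1 * Y 1 j = 0 := fun j => by
    have := congrFun (congrFun h2 w) j
    simpa [Matrix.mul_apply, Fin.sum_univ_two] using this
  have e3 : ∀ j, X j 0 * C 0 v + X j 1 * C 1 v = 0 := fun j => by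
    have := congrFun (congrFun h3 j) v
    simpa [Matrix.mul_apply, Fin.sum_univ_two] using this
  have e4 : ∀ j, Y j 0 * C 0 v + Y j 1 * C 1 v = 0 := fun j => by
    have := congrFun (congrFun h4 j) v
    simpa [Matrix.mul_apply, Fin.sum_univ_two] using this
  obtain ⟨α, x, hx⟩ : ∃ α : Fin 2 → Fin 2 → ℂ, ∃ x y : ℂ,
      (∀ i j, X i j = x * α i j) ∧ (∀ i j, Y i j = y * α i j) := by
    have a0 := e1 0; have a1 := e1 1; have b0 := e2 0; have b1 := e2 1
    have c0 := e3 0; have c1 := e3 1; have d0 := e4 0; have d1 := e4 1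
    have key : ∀ p r : ℂ, (p ≠ 0 ∨ r ≠ 0) → ∀ s t : ℂ, p * s + r * t = 0 →
        ∃ u, s = u * r ∧ t = - u * p := by
      intro p r hpr s t hst
      rcases hpr with hp | hr
      · refine ⟨- t / p, ?_, ?_⟩
        · field_simp; linear_combination hst
        · field_simp
      · refine ⟨s / r, ?_, ?_⟩
        · field_simp
        · field_simp; linear_combination hst
    have hA' : A w 0 ≠ 0 ∨ A w 1 ≠ 0 := by
      obtain ⟨j, hj⟩ := hw; fin_cases j
      · exact Or.inl hj
      · exact Or.inr hj
    have hC' : C 0 v ≠ 0 ∨ C 1 v ≠ 0 := by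
      obtain ⟨j, hj⟩ := hv; fin_cases j
      · exact Or.inl hj
      · exact Or.inr hj
    have main : ∀ X : Matrix (Fin 2) (Fin 2) ℂ,
        (∀ j, A w 0 * X 0 j + A w 1 * X 1 j = 0) → (∀ j, X j 0 * C 0 v + X j 1 * C 1 v = 0) →
        ∃ x, ∀ i j, X i j = x * (![A w 1, - A w 0] i * ![C 1 v, - C 0 v] j) := by
      intro X f1 f2
      obtain ⟨u0, p0, r0⟩ := key _ _ hA' _ _ (f1 0)
      obtain ⟨u1, p1, r1⟩ := key _ _ hA' _ _ (f1 1)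
      have g : C 0 v * u0 + C 1 v * u1 = 0 := by
        rcases hA' with h | h
        · apply mul_left_cancel₀ h
          have := f2 1; rw [r0, r1] at this; linear_combination -this
        · apply mul_left_cancel₀ h
          have := f2 0; rw [p0, p1] at this; linear_combination this
      obtain ⟨x, y0, y1⟩ := key _ _ hC' _ _ g
      refine ⟨x, fun i j => ?_⟩
      fin_cases i <;> fin_cases j <;> simp [p0, p1, r0, r1, y0, y1] <;> ring
    obtain ⟨x, hx⟩ := main X e1 e3
    obtain ⟨y, hy⟩ := main Y e2 e4
    exact ⟨_, x, y, hx, hy⟩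
  obtain ⟨y, hX, hY⟩ := hx
  simp only [Matrix.trace, Matrix.diag, Matrix.mul_apply, Fin.sum_univ_two, hX, hY]
  ring

/-- Value of the limit tensor on a word beginning with `x y z` whose tail has no diagonal letter
and matrix-unit product `R`. -/
noncomputable def valR (R : Matrix (Fin 2) (Fin 2) ℂ) (x y z : Fin 4) : ℂ :=
  if [x, y, z].countP isDg = 1 then
    Matrix.trace (unitMat x * (unitMat y * (unitMat z * R))) else 0

lemma core (A B C : Fin 4 → Matrix (Fin 2) (Fin 2) ℂ) (P₁ P₂ R₁ R₂ : Matrix (Fin 2) (Fin 2) ℂ)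
    (hR : (R₁ = 1 ∧ R₂ = 1) ∨ (R₁ = unitMat 0 ∧ R₂ = unitMat 3))
    (h1 : ∀ x y z, Matrix.trace (A x * (B y * (C z * P₁))) = valR R₁ x y z)
    (h2 : ∀ x y z, Matrix.trace (A x * (B y * (C z * P₂))) = valR R₂ x y z) : False := by
  have AB : ∀ x y, isDg x → isDg y → A x * B y = 0 := by
    intro x y hx hy
    refine eq_zero_of_dual ![A 1 * B 2, A 0 * B 1, A 2 * B 1, A 3 * B 2]
      ![C 0 * P₁, C 2 * P₁, C 3 * P₂, C 1 * P₂] ?_ _ ?_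
    · intro i j
      fin_cases i <;> fin_cases j <;> simp [mul_assoc, h1, h2] <;>
        rcases hR with ⟨rfl, rfl⟩ | ⟨rfl, rfl⟩ <;>
        simp [valR, isDg, unitMat, Matrix.trace, Fin.sum_univ_two]
    · intro j
      fin_cases j <;> simp [mul_assoc, h1, h2, valR, hx, hy, List.countP_cons]
  have cyc : ∀ a b c d : Matrix (Fin 2) (Fin 2) ℂ,
      Matrix.trace (b * (c * (d * a))) = Matrix.trace (a * (b * (c * d))) := by
    intro a b c d
    rw [Matrix.trace_mul_comm a]; simp only [mul_assoc]
  have h1' : ∀ x y z, Matrix.trace (B y * (C z * (P₁ * A x))) = valR R₁ x y z := by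
    intro x y z; rw [cyc, h1]
  have h2' : ∀ x y z, Matrix.trace (B y * (C z * (P₂ * A x))) = valR R₂ x y z := by
    intro x y z; rw [cyc, h2]
  have BC : ∀ x y, isDg x → isDg y → B x * C y = 0 := by
    intro x y hx hy
    refine eq_zero_of_dual ![B 1 * C 2, B 3 * C 2, B 0 * C 1, B 2 * C 1]
      ![P₁ * A 0, P₁ * A 1, P₂ * A 2, P₂ * A 3] ?_ _ ?_
    · intro i j
      fin_cases i <;> fin_cases j <;> simp [mul_assoc, h1', h2'] <;>
        rcases hR with ⟨rfl, rfl⟩ | ⟨rfl, rfl⟩ <;>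
        simp [valR, isDg, unitMat, Matrix.trace, Fin.sum_univ_two]
    · intro j
      fin_cases j <;> simp [mul_assoc, h1', h2', valR, hx, hy, List.countP_cons] <;>
        intro h <;> exfalso <;> omega
  have hA : A 0 ≠ 0 := by
    intro h
    have := h1 0 1 2
    rw [h] at this
    rcases hR with ⟨rfl, rfl⟩ | ⟨rfl, rfl⟩ <;>
      simp [valR, isDg, unitMat, Matrix.trace, Fin.sum_univ_two] at this
  have hC : C 0 ≠ 0 := by
    intro h
    have := h1 1 2 0
    rw [h] at this
    rcases hR with ⟨rfl, rfl⟩ | ⟨rfl, rfl⟩ <;>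
      simp [valR, isDg, unitMat, Matrix.trace, Fin.sum_univ_two] at this
  have d0 : isDg 0 = true := rfl
  have d3 : isDg 3 = true := rfl
  have := cross_eq (A 0) (C 0) (B 0) (B 3) (C 1 * (P₂ * A 2)) (C 2 * (P₁ * A 1)) hA hC
    (AB _ _ d0 d0) (AB _ _ d0 d3) (BC _ _ d0 d0) (BC _ _ d3 d0)
  simp only [h1', h2'] at this
  rcases hR with ⟨rfl, rfl⟩ | ⟨rfl, rfl⟩ <;>
    simp [valR, isDg, unitMat, Matrix.trace, Fin.sum_univ_two] at this

lemma exists_word (m : ℕ) : ∃ w₁ w₂ : Fin (2 * m) → Fin 4,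
    (List.ofFn w₁).countP isDg = 0 ∧ (List.ofFn w₂).countP isDg = 0 ∧
    ((((List.ofFn w₁).map unitMat).prod = 1 ∧ ((List.ofFn w₂).map unitMat).prod = 1) ∨
    (((List.ofFn w₁).map unitMat).prod = unitMat 0 ∧
      ((List.ofFn w₂).map unitMat).prod = unitMat 3)) := by
  induction m with
  | zero => exact ⟨fun _ => 0, fun _ => 0, by simp⟩
  | succ m ih =>
    obtain ⟨w₁, w₂, c1, c2, h⟩ := ih
    refine ⟨(Fin.cons 1 (Fin.cons 2 w₁ : Fin (2 * m + 1) → Fin 4) : Fin (2 * m + 1 + 1) → Fin 4),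
      (Fin.cons 2 (Fin.cons 1 w₂ : Fin (2 * m + 1) → Fin 4) : Fin (2 * m + 1 + 1) → Fin 4),
      ?_, ?_, Or.inr ?_⟩
    · change (List.ofFn (n := 2 * m + 1 + 1) _).countP isDg = 0
      rw [List.ofFn_cons, List.ofFn_cons]
      simp only [List.countP_cons, c1]; decide
    · change (List.ofFn (n := 2 * m + 1 + 1) _).countP isDg = 0
      rw [List.ofFn_cons, List.ofFn_cons]
      simp only [List.countP_cons, c2]; decide
    · change ((List.ofFn (n := 2 * m + 1 + 1) _).map unitMat).prod = unitMat 0 ∧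
        ((List.ofFn (n := 2 * m + 1 + 1) _).map unitMat).prod = unitMat 3
      rw [List.ofFn_cons, List.ofFn_cons, List.ofFn_cons, List.ofFn_cons]
      simp only [List.map_cons, List.prod_cons]
      rcases h with ⟨e1, e2⟩ | ⟨e1, e2⟩ <;> rw [e1, e2] <;> constructor <;> ext i j <;>
        fin_cases i <;> fin_cases j <;> simp [unitMat]

lemma valT_not_mps (m : ℕ) (M : Fin (2 * m + 1 + 1 + 1) → Fin 4 → Matrix (Fin 2) (Fin 2) ℂ)
    (h : ∀ i : Fin (2 * m + 1 + 1 + 1) → Fin 4,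
      valT (List.ofFn i) = Matrix.trace (List.ofFn fun j => M j (i j)).prod) : False := by
  obtain ⟨w₁, w₂, c1, c2, hw⟩ := exists_word m
  have key : ∀ w : Fin (2 * m) → Fin 4, (List.ofFn w).countP isDg = 0 → ∀ x y z,
      Matrix.trace (M 0 x * (M (Fin.succ 0) y * (M (Fin.succ (Fin.succ 0)) z *
        (List.ofFn fun j => M j.succ.succ.succ (w j)).prod)))
      = valR ((List.ofFn w).map unitMat).prod x y z := by
    intro w hw x y z
    have := h (Fin.cons x (Fin.cons y (Fin.cons z w : Fin (2 * m + 1) → Fin 4) :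
      Fin (2 * m + 1 + 1) → Fin 4))
    rw [List.ofFn_cons, List.ofFn_cons, List.ofFn_cons, List.ofFn_succ, List.ofFn_succ,
      List.ofFn_succ] at this
    simp only [Fin.cons_zero, Fin.cons_succ, List.prod_cons] at this
    rw [← this, valT, valR]
    simp only [List.countP_cons, hw, List.map_cons, List.prod_cons, List.countP_nil]
  exact core _ _ _ _ _ _ _ hw (key w₁ c1) (key w₂ c2)

/-- Theorem 4.6 (strengthened form): for every odd integer `q > 1`, there is a tensor
in the closure of `IMPS(2,4,q)` that does not lie in `MPS((2,…,2),(4,…,4),q)`. -/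
theorem exists_mem_closure_imps_not_mem_mps (q : ℕ) (hq : 1 < q) (hodd : Odd q) :
    ∃ T : (Fin q → Fin 4) → ℂ,
      T ∈ closure {T : (Fin q → Fin 4) → ℂ |
        ∃ M : Fin 4 → Matrix (Fin 2) (Fin 2) ℂ,
          ∀ i : Fin q → Fin 4, T i = Matrix.trace (List.ofFn fun j => M (i j)).prod} ∧
      ¬ ∃ M : Fin q → Fin 4 → Matrix (Fin 2) (Fin 2) ℂ,
          ∀ i : Fin q → Fin 4, T i = Matrix.trace (List.ofFn fun j => M j (i j)).prod := by
  refine ⟨fun i => valT (List.ofFn i), valT_mem_closure q hq hodd, ?_⟩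
  rintro ⟨M, hM⟩
  obtain ⟨m, rfl⟩ : ∃ m, q = 2 * m + 1 + 1 + 1 := by
    obtain ⟨k, rfl⟩ := hodd
    exact ⟨k - 1, by omega⟩
  exact valT_not_mps m M hM
end

section
/- Corollary (non-closedness of MPS): For every odd integer q > 1, the set MPS((2,…,2),(4,…,4),q) ⊆ ((Fin q → Fin 4) → ℂ) is not a closed subset of the space of tensors with its standard topology. (This follows since IMPS(2,4,q) ⊆ MPS((2,…,2),(4,…,4),q) and the closure of IMPS(2,4,q) contains a point outside MPS((2,…,2),(4,…,4),q).) -/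
set_option linter.unusedSimpArgs false

/-- The four matrix units of size two. -/
def mpsE : Fin 4 → Matrix (Fin 2) (Fin 2) ℂ :=
  ![!![1, 0; 0, 0], !![0, 1; 0, 0], !![0, 0; 1, 0], !![0, 0; 0, 1]]

/-- Weight: one for diagonal matrix units, zero for off-diagonal ones. -/
def mpsW : Fin 4 → ℕ := ![1, 0, 0, 1]

/-- Limit tensor. -/
noncomputable def mpsT (q : ℕ) (i : Fin q → Fin 4) : ℂ :=
  if ∑ j, mpsW (i j) = 1 then Matrix.trace (List.ofFn fun j => mpsE (i j)).prod else 0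

lemma mps_off : ∀ (q : ℕ) (i : Fin q → Fin 4), (∀ j, mpsW (i j) = 0) →
    (Odd q → (List.ofFn fun j => mpsE (i j)).prod 0 0 = 0 ∧
      (List.ofFn fun j => mpsE (i j)).prod 1 1 = 0) ∧
    (Even q → (List.ofFn fun j => mpsE (i j)).prod 0 1 = 0 ∧
      (List.ofFn fun j => mpsE (i j)).prod 1 0 = 0) := by
  intro q
  induction q with
  | zero => intro i _; simp
  | succ n ih =>
    intro i hi
    obtain ⟨h1, h2⟩ := ih (fun j => i j.succ) (fun j => hi j.succ)
    have h0 := hi 0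
    rw [List.ofFn_succ, List.prod_cons]
    generalize (List.ofFn fun j : Fin n => mpsE (i j.succ)).prod = R at *
    generalize i 0 = x at *
    constructor
    · intro ho
      obtain ⟨a, b⟩ := h2 (by grind)
      fin_cases x <;> simp [mpsW, mpsE, Matrix.mul_apply, Matrix.vecMul, dotProduct, Fin.sum_univ_two, a, b] at h0 ⊢
    · intro ho
      obtain ⟨a, b⟩ := h1 (by grind)
      fin_cases x <;> simp [mpsW, mpsE, Matrix.mul_apply, Matrix.vecMul, dotProduct, Fin.sum_univ_two, a, b] at h0 ⊢

lemma mps_scale (t : ℂ) : ∀ (q : ℕ) (i : Fin q → Fin 4),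
    (List.ofFn fun j => t ^ mpsW (i j) • mpsE (i j)).prod =
      t ^ (∑ j, mpsW (i j)) • (List.ofFn fun j => mpsE (i j)).prod := by
  intro q
  induction q with
  | zero => intro i; simp
  | succ n ih =>
    intro i
    rw [List.ofFn_succ, List.prod_cons, ih (fun j => i j.succ), List.ofFn_succ, List.prod_cons,
      Fin.sum_univ_succ, pow_add, Matrix.smul_mul, Matrix.mul_smul, smul_smul]

/-- Alternating pattern 1, 2, 1, 2, ... -/
def mpsR (k : ℕ) : Fin k → Fin 4 := fun j => if j.val % 2 = 0 then 1 else 2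

/-- Alternating pattern 2, 1, 2, 1, ... -/
def mpsR' (k : ℕ) : Fin k → Fin 4 := fun j => if j.val % 2 = 0 then 2 else 1

lemma mpsR_prod (k : ℕ) :
    (List.ofFn fun j => mpsE (mpsR (2 * k) j)).prod 0 0 = 1 ∧
    (List.ofFn fun j => mpsE (mpsR (2 * k) j)).prod 0 1 = 0 ∧
    (List.ofFn fun j => mpsE (mpsR (2 * k) j)).prod 1 0 = 0 := by
  induction k with
  | zero => simp
  | succ n ih =>
    have e : (fun j : Fin (2 * n) => mpsE (mpsR (2 * n + 1 + 1) j.succ.succ)) =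
        fun j => mpsE (mpsR (2 * n) j) := by
      funext j; simp [mpsR, add_assoc]
    rw [show 2 * (n + 1) = 2 * n + 1 + 1 by ring, List.ofFn_succ, List.ofFn_succ, List.prod_cons,
      List.prod_cons, e]
    obtain ⟨a, b, c⟩ := ih
    generalize (List.ofFn fun j => mpsE (mpsR (2 * n) j)).prod = R at *
    simp [mpsR, mpsE, Matrix.mul_apply, Matrix.vecMul, dotProduct, Fin.sum_univ_two, a, b]

lemma mpsR'_prod (k : ℕ) :
    (List.ofFn fun j => mpsE (mpsR' (2 * k) j)).prod 1 1 = 1 ∧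
    (List.ofFn fun j => mpsE (mpsR' (2 * k) j)).prod 0 1 = 0 ∧
    (List.ofFn fun j => mpsE (mpsR' (2 * k) j)).prod 1 0 = 0 := by
  induction k with
  | zero => simp
  | succ n ih =>
    have e : (fun j : Fin (2 * n) => mpsE (mpsR' (2 * n + 1 + 1) j.succ.succ)) =
        fun j => mpsE (mpsR' (2 * n) j) := by
      funext j; simp [mpsR', add_assoc]
    rw [show 2 * (n + 1) = 2 * n + 1 + 1 by ring, List.ofFn_succ, List.ofFn_succ, List.prod_cons,
      List.prod_cons, e]
    obtain ⟨a, b, c⟩ := ih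
    generalize (List.ofFn fun j => mpsE (mpsR' (2 * n) j)).prod = R at *
    simp [mpsR', mpsE, Matrix.mul_apply, Matrix.vecMul, dotProduct, Fin.sum_univ_two, a, c]

lemma mpsT_cons (m : ℕ) (x y z : Fin 4) (r : Fin m → Fin 4) (hr : ∀ j, mpsW (r j) = 0) :
    mpsT (m + 1 + 1 + 1) (Fin.cons x (Fin.cons y (Fin.cons z r) : Fin (m + 1 + 1) → Fin 4)) =
      if mpsW x + mpsW y + mpsW z = 1 then
        Matrix.trace (mpsE x * mpsE y * mpsE z * (List.ofFn fun j => mpsE (r j)).prod) else 0 := by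
  simp [mpsT, Fin.sum_univ_succ, List.ofFn_succ, hr, Matrix.mul_assoc, add_assoc]

/-- The algebraic core. -/
lemma mps_core (A B C : Fin 4 → Matrix (Fin 2) (Fin 2) ℂ) (P P' R R' : Matrix (Fin 2) (Fin 2) ℂ)
    (hR : R 0 0 = 1 ∧ R 0 1 = 0 ∧ R 1 0 = 0) (hR' : R' 1 1 = 1 ∧ R' 0 1 = 0 ∧ R' 1 0 = 0)
    (h : ∀ x y z, (if mpsW x + mpsW y + mpsW z = 1 then
        Matrix.trace (mpsE x * mpsE y * mpsE z * R) else 0) = Matrix.trace (A x * B y * C z * P))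
    (h' : ∀ x y z, (if mpsW x + mpsW y + mpsW z = 1 then
        Matrix.trace (mpsE x * mpsE y * mpsE z * R') else 0) =
        Matrix.trace (A x * B y * C z * P')) : False := by
  obtain ⟨a, b, c⟩ := hR
  obtain ⟨a', b', c'⟩ := hR'
  have hC : LinearIndependent ℂ C := by
    rw [Fintype.linearIndependent_iff]
    intro v hv
    have key : ∀ x y, ∑ z, v z * Matrix.trace (A x * B y * C z * P) = 0 := by
      intro x y
      have : Matrix.trace (A x * B y * (∑ z, v z • C z) * P) = 0 := by rw [hv]; simp
      simpa [Matrix.mul_sum, Matrix.sum_mul, Matrix.trace_sum] using this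
    have key' : ∀ x y, ∑ z, v z * Matrix.trace (A x * B y * C z * P') = 0 := by
      intro x y
      have : Matrix.trace (A x * B y * (∑ z, v z • C z) * P') = 0 := by rw [hv]; simp
      simpa [Matrix.mul_sum, Matrix.sum_mul, Matrix.trace_sum] using this
    simp only [← h, ← h', Fin.sum_univ_four] at key key'
    have k1 := key 0 1
    have k2 := key 1 2
    have k3 := key' 2 1
    have k4 := key' 3 2
    simp [mpsW, mpsE, Matrix.trace_fin_two, Matrix.mul_apply, Matrix.vecMul, dotProduct, Fin.sum_univ_two, a, b, c, a', b', c'] at k1 k2 k3 k4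
    intro i
    fin_cases i <;> simpa
  have hB : LinearIndependent ℂ B := by
    rw [Fintype.linearIndependent_iff]
    intro v hv
    have key : ∀ x z, ∑ y, v y * Matrix.trace (A x * B y * C z * P) = 0 := by
      intro x z
      have : Matrix.trace (A x * (∑ z, v z • B z) * C z * P) = 0 := by rw [hv]; simp
      simpa [Matrix.mul_sum, Matrix.sum_mul, Matrix.trace_sum] using this
    have key' : ∀ x z, ∑ y, v y * Matrix.trace (A x * B y * C z * P') = 0 := by
      intro x z
      have : Matrix.trace (A x * (∑ z, v z • B z) * C z * P') = 0 := by rw [hv]; simp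
      simpa [Matrix.mul_sum, Matrix.sum_mul, Matrix.trace_sum] using this
    simp only [← h, ← h', Fin.sum_univ_four] at key key'
    have k1 := key 0 2
    have k2 := key 1 2
    have k3 := key 1 0
    have k4 := key' 2 1
    simp [mpsW, mpsE, Matrix.trace_fin_two, Matrix.mul_apply, Matrix.vecMul, dotProduct, Fin.sum_univ_two, a, b, c, a', b', c'] at k1 k2 k3 k4
    intro i
    fin_cases i <;> simpa
  have sC : ∀ X, ∃ v : Fin 4 → ℂ, ∑ z, v z • C z = X := by
    intro X
    have := hC.span_eq_top_of_card_eq_finrank (by simp [Module.finrank_matrix])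
    have hX : X ∈ Submodule.span ℂ (Set.range C) := by rw [this]; trivial
    exact (Submodule.mem_span_range_iff_exists_fun ℂ).1 hX
  have sB : ∀ X, ∃ v : Fin 4 → ℂ, ∑ z, v z • B z = X := by
    intro X
    have := hB.span_eq_top_of_card_eq_finrank (by simp [Module.finrank_matrix])
    have hX : X ∈ Submodule.span ℂ (Set.range B) := by rw [this]; trivial
    exact (Submodule.mem_span_range_iff_exists_fun ℂ).1 hX
  obtain ⟨G, hG⟩ : ∃ G, G = P * A 0 := ⟨_, rfl⟩
  have hg : ∀ y z, Matrix.trace (G * B y * C z) = Matrix.trace (A 0 * B y * C z * P) := by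
    intro y z
    rw [hG, Matrix.trace_mul_comm _ P]; simp only [Matrix.mul_assoc]
  have z0 : ∀ y, y ≠ 1 → G * B y = 0 := by
    intro y hy
    have h0 : ∀ z, Matrix.trace (G * B y * C z) = 0 := by
      intro z
      rw [hg, ← h]
      fin_cases y <;> fin_cases z <;>
        simp [mpsW, mpsE, Matrix.trace_fin_two, Matrix.mul_apply, Matrix.vecMul, dotProduct, Fin.sum_univ_two, b, c] at hy ⊢
    have hX : ∀ X, Matrix.trace (G * B y * X) = 0 := by
      intro X
      obtain ⟨v, rfl⟩ := sC X
      simp [Matrix.mul_sum, Matrix.trace_sum, h0]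
    ext i j
    have := hX (Matrix.single j i 1)
    simpa [Matrix.trace_mul_single] using this
  have n0 : G ≠ 0 := by
    intro h0
    have := hg 1 2
    rw [← h, h0] at this
    simp [mpsW, mpsE, Matrix.trace_fin_two, Matrix.mul_apply, Matrix.vecMul, dotProduct, Fin.sum_univ_two, a] at this
  have line : ∀ X, ∃ s : ℂ, G * X = s • (G * B 1) := by
    intro X
    obtain ⟨v, rfl⟩ := sB X
    refine ⟨v 1, ?_⟩
    simp [Fin.sum_univ_four, Matrix.mul_add, z0]
  apply n0
  ext i j
  by_contra hne
  obtain ⟨s, hs⟩ := line (Matrix.single j 0 1)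
  obtain ⟨t, ht⟩ := line (Matrix.single j 1 1)
  have s0 := congrFun (congrFun hs i) 0
  have s1 := congrFun (congrFun hs i) 1
  have t0 := congrFun (congrFun ht i) 0
  have t1 := congrFun (congrFun ht i) 1
  generalize G * B 1 = H at *
  simp at s0 s1 t0 t1 hne
  grind

/-- Corollary of Theorem 4.6: for every odd integer `q > 1`, the set
`MPS((2,…,2),(4,…,4),q)` is not a closed subset of the space of tensors
`(Fin q → Fin 4) → ℂ`. -/
theorem mps_two_four_odd_not_closed (q : ℕ) (hq : 1 < q) (hodd : Odd q) :
    ¬ IsClosed {T : (Fin q → Fin 4) → ℂ |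
      ∃ M : Fin q → Fin 4 → Matrix (Fin 2) (Fin 2) ℂ,
        ∀ i : Fin q → Fin 4, T i = Matrix.trace (List.ofFn fun j => M j (i j)).prod} := by
  obtain ⟨k, rfl⟩ : ∃ k, q = 2 * k + 1 + 1 + 1 := by
    obtain ⟨l, rfl⟩ := hodd
    exact ⟨l - 1, by omega⟩
  intro hcl
  have hmem : mpsT (2 * k + 1 + 1 + 1) ∈ {T : (Fin (2 * k + 1 + 1 + 1) → Fin 4) → ℂ |
      ∃ M : Fin (2 * k + 1 + 1 + 1) → Fin 4 → Matrix (Fin 2) (Fin 2) ℂ,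
        ∀ i : Fin (2 * k + 1 + 1 + 1) → Fin 4,
          T i = Matrix.trace (List.ofFn fun j => M j (i j)).prod} := by
    have ht : Filter.Tendsto (fun n : ℕ => (1 / ((n : ℂ) + 1))) Filter.atTop (nhds 0) :=
      tendsto_one_div_add_atTop_nhds_zero_nat
    refine hcl.mem_of_tendsto (b := Filter.atTop) (f := fun (n : ℕ) i =>
      (1 / ((n : ℂ) + 1))⁻¹ * Matrix.trace
        (List.ofFn fun j => (1 / ((n : ℂ) + 1)) ^ mpsW (i j) • mpsE (i j)).prod) ?_ ?_
    · rw [tendsto_pi_nhds]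
      intro i
      simp only [mps_scale, Matrix.trace_smul, smul_eq_mul]
      have hn : ∀ n : ℕ, (1 / ((n : ℂ) + 1)) ≠ 0 := fun n =>
        one_div_ne_zero (Nat.cast_add_one_ne_zero n)
      unfold mpsT
      rcases hs : ∑ j, mpsW (i j) with _ | _ | w
      · have hz : ∀ j, mpsW (i j) = 0 := by simpa using hs
        obtain ⟨u, v⟩ := (mps_off _ i hz).1 hodd
        have hz' : Matrix.trace (List.ofFn fun j => mpsE (i j)).prod = 0 := by
          rw [Matrix.trace_fin_two, u, v, add_zero]
        simp only [hz', mul_zero, ite_self]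
        exact tendsto_const_nhds
      · simp only [zero_add, pow_one, if_true]
        refine tendsto_const_nhds.congr fun n => ?_
        rw [inv_mul_cancel_left₀ (hn n)]
      · rw [if_neg (by omega)]
        have := (ht.pow (w + 1)).mul_const (Matrix.trace (List.ofFn fun j => mpsE (i j)).prod)
        rw [zero_pow (by omega), zero_mul] at this
        refine this.congr fun n => ?_
        rw [pow_succ _ (w + 1), mul_comm (_ ^ (w + 1)) (1 / ((n : ℂ) + 1)), mul_assoc (1 / ((n : ℂ) + 1)),
          inv_mul_cancel_left₀ (hn n)]
    · refine Filter.Eventually.of_forall fun n => ?_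
      refine ⟨fun j x => (if j = 0 then (1 / ((n : ℂ) + 1))⁻¹ else 1) •
        ((1 / ((n : ℂ) + 1)) ^ mpsW x • mpsE x), fun i => ?_⟩
      beta_reduce
      simp only [List.ofFn_succ (n := 2 * k + 1 + 1)]
      simp only [List.prod_cons, if_true, Fin.succ_ne_zero, if_false, one_smul, Matrix.smul_mul,
        Matrix.trace_smul, smul_eq_mul]
  obtain ⟨M, hM⟩ := hmem
  refine mps_core (M 0) (M 1) (M 2)
    (List.ofFn fun j : Fin (2 * k) => M j.succ.succ.succ (mpsR (2 * k) j)).prod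
    (List.ofFn fun j : Fin (2 * k) => M j.succ.succ.succ (mpsR' (2 * k) j)).prod
    _ _ (mpsR_prod k) (mpsR'_prod k) (fun x y z => ?_) (fun x y z => ?_)
  · rw [← mpsT_cons _ x y z (mpsR (2 * k)) (fun j => by unfold mpsR; split_ifs <;> rfl), hM]
    simp only [List.ofFn_succ, List.prod_cons, Fin.cons_zero, Fin.cons_succ, Matrix.mul_assoc]
    rfl
  · rw [← mpsT_cons _ x y z (mpsR' (2 * k)) (fun j => by unfold mpsR'; split_ifs <;> rfl), hM]
    simp only [List.ofFn_succ, List.prod_cons, Fin.cons_zero, Fin.cons_succ, Matrix.mul_assoc]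
    rfl
end
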